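/- Let μ be symmetric. Suppose there are sequences a_n, b_n > 0 with a_n^{−1/2}/(A n^a) → 1 and b_n/(B n^b) → 1 for some constants A, B, b > 0 and a ∈ ℝ, and ν > −1 with 2a+1 = 2b(ν+1). Assume, uniformly on compact subsets of ℂ, (−1)^n a_n^{1/2} p_{2n}(z/b_n) → φ_ν(z) and (−1)^n a_n^{1/2} p_{2n+1}(z/b_n) → z·φ_{ν+1}(z), and assume the leading coefficients γ_n of p_n satisfy lim_n (γ_{2n}/γ_{2n+1}) · b_n/n = 1/(2b) and lim_n (γ_{2n+1}/γ_{2n+2}) · b_n/n = 1/(2b). Then for every integer j ≥ 0, uniformly on compact subsets of ℂ, (−1)^n (a_n^{1/2}/b_n^j) p_{2n}^{[2j]}(z/b_n) → φ_{ν+j}(z) and (−1)^n (a_n^{1/2}/b_n^j) p_{2n+1}^{[2j]}(z/b_n) → z·φ_{ν+j+1}(z). -/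

import Mathlib

open MeasureTheory Polynomial Filter Topology

noncomputable section

/-- The support of a Borel measure on `ℝ`. -/
def measSupport (μ : Measure ℝ) : Set ℝ := {x | ∀ U ∈ nhds x, μ U ≠ 0}

/-- `P` is a sequence of orthonormal polynomials with respect to the measure `μ`. -/
def IsOPS (μ : Measure ℝ) (P : ℕ → Polynomial ℝ) : Prop :=
  (∀ n, (P n).degree = n) ∧ (∀ n, 0 < (P n).leadingCoeff) ∧
    ∀ n m, (∫ x, (P n).eval x * (P m).eval x ∂μ) = if n = m then 1 else 0

/-- The modified measure `dμ_j(x) = x^j dμ(x)` (that is, `(x-c)^j dμ` with `c = 0`). -/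
def muMod (μ : Measure ℝ) (c : ℝ) (j : ℕ) : Measure ℝ :=
  μ.withDensity fun x => ENNReal.ofReal ((x - c) ^ j)

/-- `φ_ν(z) = Σ_{k≥0} (-1)^k z^{2k} / (k! Γ(k+ν+1)) = z^{-ν} J_ν(2z)`. -/
def phi (ν : ℝ) (z : ℂ) : ℂ :=
  ∑' k : ℕ, ((-1 : ℂ) ^ k * z ^ (2 * k)) /
    ((k.factorial : ℂ) * Complex.Gamma ((k : ℂ) + (ν : ℂ) + 1))

/-- `P` is a sequence of orthonormal polynomials with respect to the linear functional `L`. -/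
def IsFunctionalOPS (L : ℝ[X] →ₗ[ℝ] ℝ) (P : ℕ → ℝ[X]) : Prop :=
  (∀ n, (P n).degree = n) ∧ (∀ n, 0 < (P n).leadingCoeff) ∧
    ∀ n m, L (P n * P m) = if n = m then 1 else 0

lemma comp_neg_X_coeff (r : ℝ[X]) (m : ℕ) : (r.comp (-X)).coeff m = (-1) ^ m * r.coeff m := by
  rw [show (-X : ℝ[X]) = C (-1) * X by simp, comp_C_mul_X_coeff, mul_comm]

namespace IsFunctionalOPS

variable {L : ℝ[X] →ₗ[ℝ] ℝ} {P R : ℕ → ℝ[X]}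

lemma natDegree (h : IsFunctionalOPS L P) (n : ℕ) : (P n).natDegree = n :=
  natDegree_eq_of_degree_eq_some (h.1 n)

lemma coeff_self (h : IsFunctionalOPS L P) (n : ℕ) :
    (P n).coeff n = (P n).leadingCoeff := by
  rw [leadingCoeff, h.natDegree]

lemma coeff_of_lt (h : IsFunctionalOPS L P) {n m : ℕ} (hm : n < m) : (P n).coeff m = 0 :=
  coeff_eq_zero_of_natDegree_lt (by rwa [h.natDegree])

lemma exists_expansion (h : IsFunctionalOPS L P) (N : ℕ) (r : ℝ[X]) (hr : r.degree < N) :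
    ∃ c : ℕ → ℝ, r = ∑ k ∈ Finset.range N, C (c k) * P k := by
  induction N generalizing r with
  | zero =>
    refine ⟨0, ?_⟩
    simpa using hr
  | succ N ih =>
    have hγ := h.2.1 N
    obtain ⟨c, hc⟩ := ih (r - C (r.coeff N / (P N).leadingCoeff) * P N) (by
      rw [degree_lt_iff_coeff_zero] at hr ⊢
      intro m hm
      rcases hm.eq_or_lt with rfl | hm
      · simp [h.coeff_self, hγ.ne']
      · simp [h.coeff_of_lt hm, hr m hm])
    refine ⟨fun k => if k = N then r.coeff N / (P N).leadingCoeff else c k, ?_⟩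
    rw [Finset.sum_range_succ]
    dsimp only
    rw [if_pos rfl, ← sub_eq_iff_eq_add, hc]
    refine Finset.sum_congr rfl fun k hk => ?_
    rw [if_neg (Finset.mem_range.1 hk).ne]

lemma expansion (h : IsFunctionalOPS L P) {N : ℕ} {r : ℝ[X]} (hr : r.degree < N) :
    r = ∑ k ∈ Finset.range N, C (L (r * P k)) * P k := by
  obtain ⟨c, hc⟩ := h.exists_expansion N r hr
  nth_rw 1 [hc]
  refine Finset.sum_congr rfl fun k hk => ?_
  rw [hc, Finset.sum_mul, map_sum]
  simp only [C_mul', smul_mul_assoc, map_smul, h.2.2]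
  simp [Finset.mem_range.1 hk]

lemma orthogonal (h : IsFunctionalOPS L P) {n : ℕ} {r : ℝ[X]} (hr : r.degree < n) :
    L (r * P n) = 0 := by
  obtain ⟨c, hc⟩ := h.exists_expansion n r hr
  rw [hc, Finset.sum_mul, map_sum]
  refine Finset.sum_eq_zero fun k hk => ?_
  simp [C_mul', h.2.2, (Finset.mem_range.1 hk).ne]

lemma eq_of_eq_C_mul (h : IsFunctionalOPS L P) {n : ℕ} {r : ℝ[X]} {c : ℝ}
    (hr : r = C c * P n) (hlead : 0 < r.leadingCoeff) (hnorm : L (r * r) = 1) : r = P n := by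
  have hc : c * c = 1 := by
    rw [hr, show C c * P n * (C c * P n) = C (c * c) * (P n * P n) by rw [C_mul]; ring,
      C_mul', map_smul, h.2.2] at hnorm
    simpa using hnorm
  rw [hr, leadingCoeff_mul, leadingCoeff_C] at hlead
  have hc0 : 0 < c := pos_of_mul_pos_left hlead (h.2.1 n).le
  have : c = 1 := by nlinarith
  simp [hr, this]

/-- Orthonormal polynomials with positive leading coefficients are unique. -/
lemma unique (h : IsFunctionalOPS L P) (h' : IsFunctionalOPS L R) (n : ℕ) : R n = P n := by
  refine h.eq_of_eq_C_mul (c := L (R n * P n)) ?_ (h'.2.1 n) (by simp [h'.2.2])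
  nth_rw 1 [h.expansion (r := R n) (N := n + 1) (by rw [h'.1]; exact_mod_cast n.lt_succ_self)]
  rw [Finset.sum_range_succ, Finset.sum_eq_zero, zero_add]
  intro k hk
  rw [mul_comm (R n), h'.orthogonal (by rw [h.1]; exact_mod_cast Finset.mem_range.1 hk)]
  simp

/-- Orthonormal polynomials of a symmetric functional have the parity of their degree. -/
lemma comp_neg_X (h : IsFunctionalOPS L P) (hL : ∀ r : ℝ[X], L (r.comp (-X)) = L r) (n : ℕ) :
    (P n).comp (-X) = C ((-1) ^ n) * P n := by
  have hcoeff : ∀ (n m : ℕ), (C ((-1) ^ n) * (P n).comp (-X)).coeff m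
      = (-1) ^ n * ((-1) ^ m * (P n).coeff m) := by
    intro n m
    rw [coeff_C_mul, comp_neg_X_coeff]
  have hdeg : ∀ n, (C ((-1 : ℝ) ^ n) * (P n).comp (-X)).degree = n := by
    intro n
    refine le_antisymm ?_ ?_
    · rw [degree_le_iff_coeff_zero]
      intro m hm
      rw [hcoeff, h.coeff_of_lt (by exact_mod_cast hm)]
      simp
    · apply le_degree_of_ne_zero
      rw [hcoeff, h.coeff_self]
      simpa using (h.2.1 n).ne'
  have hR : IsFunctionalOPS L (fun n => C ((-1) ^ n) * (P n).comp (-X)) := by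
    refine ⟨hdeg, fun n => ?_, fun n m => ?_⟩
    · rw [leadingCoeff, natDegree_eq_of_degree_eq_some (hdeg n), hcoeff, h.coeff_self, ← mul_assoc,
        ← mul_pow]
      simpa using h.2.1 n
    · dsimp only
      rw [show C ((-1 : ℝ) ^ n) * (P n).comp (-X) * (C ((-1) ^ m) * (P m).comp (-X))
        = C ((-1) ^ n * (-1) ^ m) * (P n * P m).comp (-X) by rw [C_mul, mul_comp]; ring, C_mul',
        map_smul, hL, h.2.2]
      split_ifs with hnm
      · subst hnm
        rw [← mul_pow]
        simp
      · simp
  rw [← h.unique hR n, ← mul_assoc, ← C_mul, ← mul_pow, h.unique hR n]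
  simp

lemma coeff_eq_zero (h : IsFunctionalOPS L P) (hL : ∀ r : ℝ[X], L (r.comp (-X)) = L r) {n m : ℕ}
    (hnm : Odd (n + m)) : (P n).coeff m = 0 := by
  have := congrArg (fun q => coeff q m) (h.comp_neg_X hL n)
  simp only [comp_neg_X_coeff, coeff_C_mul] at this
  have h2 : (-1 : ℝ) ^ n * (-1) ^ m = -1 := by rw [← pow_add, hnm.neg_one_pow]
  have h3 : (-1 : ℝ) ^ m * (-1) ^ m = 1 := by rw [← mul_pow]; simp
  linear_combination (1 / 2 : ℝ) * (-1) ^ m * this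
    + (1 / 2 : ℝ) * (P n).coeff m * h2 - (1 / 2 : ℝ) * (P n).coeff m * h3

end IsFunctionalOPS

lemma functional_eq_zero_of_odd {L : ℝ[X] →ₗ[ℝ] ℝ} (hL : ∀ r : ℝ[X], L (r.comp (-X)) = L r)
    {f : ℝ[X]} (hf : f.comp (-X) = -f) : L f = 0 := by
  have := hL f
  rw [hf, map_neg] at this
  linarith

section SquareModification

variable {L L' : ℝ[X] →ₗ[ℝ] ℝ} {P Q : ℕ → ℝ[X]}

lemma functional_mul_eq_zero (hL : ∀ r : ℝ[X], L (r.comp (-X)) = L r)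
    {f g : ℝ[X]} {n m : ℕ} (hf : f.comp (-X) = C ((-1) ^ n) * f)
    (hg : g.comp (-X) = C ((-1) ^ m) * g) (hnm : Odd (n + m)) : L (f * g) = 0 := by
  apply functional_eq_zero_of_odd hL
  rw [mul_comp, hf, hg, show C ((-1 : ℝ) ^ n) * f * (C ((-1) ^ m) * g)
    = C ((-1) ^ n * (-1) ^ m) * (f * g) by rw [C_mul]; ring, ← pow_add, hnm.neg_one_pow]
  simp

lemma symm_square (hL : ∀ r : ℝ[X], L (r.comp (-X)) = L r) (hLL : ∀ r, L' r = L (X ^ 2 * r)) :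
    ∀ r : ℝ[X], L' (r.comp (-X)) = L' r := by
  intro r
  rw [hLL, hLL, ← hL (X ^ 2 * r)]
  simp

/-- `x p_{2n}^{[2]}(x) = p_{2n+1}(x)`. -/
lemma X_mul_even (hL : ∀ r : ℝ[X], L (r.comp (-X)) = L r) (hLL : ∀ r, L' r = L (X ^ 2 * r))
    (hP : IsFunctionalOPS L P) (hQ : IsFunctionalOPS L' Q) (n : ℕ) :
    X * Q (2 * n) = P (2 * n + 1) := by
  have hL' := symm_square hL hLL
  refine hP.eq_of_eq_C_mul (c := L (X * Q (2 * n) * P (2 * n + 1))) ?_ ?_ ?_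
  · have hdeg : (X * Q (2 * n)).degree < ((2 * n + 1 + 1 : ℕ) : WithBot ℕ) := by
      rw [degree_lt_iff_coeff_zero]
      intro m hm
      obtain ⟨m, rfl⟩ : ∃ k, m = k + 1 := ⟨m - 1, by omega⟩
      rw [coeff_X_mul, hQ.coeff_of_lt (by omega)]
    nth_rw 1 [hP.expansion hdeg]
    rw [Finset.sum_range_succ, Finset.sum_eq_zero, zero_add]
    intro k hk
    rw [Finset.mem_range] at hk
    suffices L (X * Q (2 * n) * P k) = 0 by simp [this]
    rcases Nat.even_or_odd k with hk' | hk'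
    · refine functional_mul_eq_zero (n := 2 * n + 1) (m := k) hL ?_ (hP.comp_neg_X hL k) ?_
      · rw [mul_comp, hQ.comp_neg_X hL', pow_succ, C_mul]
        simp
      · simpa [Nat.odd_add] using hk'
    · have hPk : P k = X * (P k).divX := by
        conv_lhs => rw [← X_mul_divX_add (P k)]
        rw [hP.coeff_eq_zero hL (by simpa using hk')]
        simp
      rw [hPk, show X * Q (2 * n) * (X * (P k).divX) = X ^ 2 * ((P k).divX * Q (2 * n)) by ring,
        ← hLL]
      apply hQ.orthogonal
      rw [degree_lt_iff_coeff_zero]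
      intro m hm
      rw [coeff_divX, hP.coeff_of_lt (by omega)]
  · simpa using hQ.2.1 (2 * n)
  · rw [show X * Q (2 * n) * (X * Q (2 * n)) = X ^ 2 * (Q (2 * n) * Q (2 * n)) by ring, ← hLL,
      hQ.2.2, if_pos rfl]

lemma functional_mul_odd_of_le (hL : ∀ r : ℝ[X], L (r.comp (-X)) = L r)
    (hLL : ∀ r, L' r = L (X ^ 2 * r))
    (hP : IsFunctionalOPS L P) (hQ : IsFunctionalOPS L' Q) {n k : ℕ} (hk : k ≤ n) :
    L (Q (2 * n + 1) * P (2 * k + 1)) = L (X * Q (2 * n + 1)) * (P (2 * k + 1)).coeff 1 := by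
  have h0 : P (2 * k + 1) = X ^ 2 * (P (2 * k + 1)).divX.divX
      + C ((P (2 * k + 1)).coeff 1) * X := by
    conv_lhs => rw [← X_mul_divX_add (P (2 * k + 1)), ← X_mul_divX_add (P (2 * k + 1)).divX]
    rw [hP.coeff_eq_zero hL (by simp [parity_simps]), coeff_divX]
    simp
    ring
  rw [h0, mul_add, map_add, show Q (2 * n + 1) * (X ^ 2 * (P (2 * k + 1)).divX.divX)
    = X ^ 2 * ((P (2 * k + 1)).divX.divX * Q (2 * n + 1)) by ring, ← hLL, hQ.orthogonal,
    ← h0, zero_add, mul_left_comm, C_mul', map_smul, mul_comm (Q _), smul_eq_mul, mul_comm]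
  rw [degree_lt_iff_coeff_zero]
  intro m hm
  rw [coeff_divX, coeff_divX, hP.coeff_of_lt (by omega)]

lemma sum_range_two_mul_eq_sum_odd {M : Type*} [AddCommMonoid M] (f : ℕ → M) (n : ℕ)
    (hf : ∀ k, Even k → f k = 0) :
    ∑ k ∈ Finset.range (2 * n), f k = ∑ k ∈ Finset.range n, f (2 * k + 1) := by
  induction n with
  | zero => simp
  | succ n ih =>
    rw [show 2 * (n + 1) = 2 * n + 1 + 1 by ring, Finset.sum_range_succ, Finset.sum_range_succ,
      Finset.sum_range_succ, ih, hf (2 * n) (by simp), add_zero]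

/-- `p_{2n+1}^{[2]}` is a multiple of the odd Christoffel–Darboux kernel at the origin. -/
lemma odd_eq_kernel (hL : ∀ r : ℝ[X], L (r.comp (-X)) = L r) (hLL : ∀ r, L' r = L (X ^ 2 * r))
    (hP : IsFunctionalOPS L P) (hQ : IsFunctionalOPS L' Q) (n : ℕ) :
    Q (2 * n + 1) = C (L (X * Q (2 * n + 1))) *
      ∑ k ∈ Finset.range (n + 1), C ((P (2 * k + 1)).coeff 1) * P (2 * k + 1) := by
  nth_rw 1 [hP.expansion (r := Q (2 * n + 1)) (N := 2 * (n + 1))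
    (by rw [hQ.1]; exact_mod_cast (by omega))]
  rw [sum_range_two_mul_eq_sum_odd, Finset.mul_sum]
  · refine Finset.sum_congr rfl fun k hk => ?_
    rw [functional_mul_odd_of_le hL hLL hP hQ (by rw [Finset.mem_range] at hk; omega), C_mul,
      mul_assoc]
  · intro k hk
    rw [functional_mul_eq_zero hL (hQ.comp_neg_X (symm_square hL hLL) _) (hP.comp_neg_X hL k)]
    · simp
    · simpa [Nat.odd_add, Nat.odd_mul] using hk

lemma odd_leadingCoeff (hL : ∀ r : ℝ[X], L (r.comp (-X)) = L r)
    (hLL : ∀ r, L' r = L (X ^ 2 * r))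
    (hP : IsFunctionalOPS L P) (hQ : IsFunctionalOPS L' Q) (n : ℕ) :
    (Q (2 * n + 1)).leadingCoeff =
      L (X * Q (2 * n + 1)) * (P (2 * n + 1)).coeff 1 * (P (2 * n + 1)).leadingCoeff := by
  rw [← hQ.coeff_self, odd_eq_kernel hL hLL hP hQ n, coeff_C_mul, finsetSum_coeff,
    Finset.sum_range_succ, Finset.sum_eq_zero, zero_add, coeff_C_mul, hP.coeff_self,
    ← odd_eq_kernel hL hLL hP hQ n, mul_assoc]
  intro k hk
  rw [Finset.mem_range] at hk
  rw [coeff_C_mul, hP.coeff_of_lt (m := 2 * n + 1) (by omega), mul_zero]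

/-- The normalisation of the kernel. -/
lemma odd_normalization (hL : ∀ r : ℝ[X], L (r.comp (-X)) = L r)
    (hLL : ∀ r, L' r = L (X ^ 2 * r))
    (hP : IsFunctionalOPS L P) (hQ : IsFunctionalOPS L' Q) (n : ℕ) :
    L (X * Q (2 * n + 1)) ^ 2 * ((P (2 * n + 1)).coeff 1 * (P (2 * n + 3)).coeff 1 *
      ((P (2 * n + 1)).leadingCoeff / (P (2 * n + 3)).leadingCoeff)) = -1 := by
  have hlead := odd_leadingCoeff hL hLL hP hQ n
  set D := L (X * Q (2 * n + 1)) with hD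
  have hL' := symm_square hL hLL
  have hlow : ∀ k, k < 2 * n + 1 → L' (Q (2 * n + 1) * P k) = 0 := by
    intro k hk
    rw [mul_comm, hQ.orthogonal]
    rw [hP.1]
    exact_mod_cast hk
  have hexp : X ^ 2 * Q (2 * n + 1) = C (L' (Q (2 * n + 1) * P (2 * n + 1))) * P (2 * n + 1)
      + C (L' (Q (2 * n + 1) * P (2 * n + 3))) * P (2 * n + 3) := by
    nth_rw 1 [hP.expansion (r := X ^ 2 * Q (2 * n + 1)) (N := 2 * (n + 2)) (by
      rw [degree_lt_iff_coeff_zero]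
      intro m hm
      obtain ⟨m, rfl⟩ : ∃ k, m = k + 2 := ⟨m - 2, by omega⟩
      rw [coeff_X_pow_mul, hQ.coeff_of_lt (by omega)])]
    simp only [mul_assoc, ← hLL]
    rw [sum_range_two_mul_eq_sum_odd, Finset.sum_range_succ, Finset.sum_range_succ,
      Finset.sum_eq_zero, zero_add]
    · rfl
    · intro k hk
      rw [Finset.mem_range] at hk
      rw [hlow _ (by omega)]
      simp
    · intro k hk
      rw [functional_mul_eq_zero hL' (hQ.comp_neg_X hL' _) (hP.comp_neg_X hL k)]
      · simp
      · simpa [Nat.odd_add, Nat.odd_mul] using hk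
  have hβ : D * (P (2 * n + 1)).coeff 1 * L' (Q (2 * n + 1) * P (2 * n + 1)) = 1 := by
    have h1 : L' (Q (2 * n + 1) * Q (2 * n + 1)) = 1 := by simp [hQ.2.2]
    nth_rw 2 [odd_eq_kernel hL hLL hP hQ n] at h1
    rw [mul_left_comm, C_mul', map_smul, Finset.mul_sum, map_sum, Finset.sum_range_succ,
      Finset.sum_eq_zero, zero_add, mul_left_comm, C_mul', map_smul] at h1
    · rw [← h1]
      simp [mul_assoc, hD]
    · intro k hk
      rw [Finset.mem_range] at hk
      rw [mul_left_comm, C_mul', map_smul, hlow _ (by omega), smul_zero]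
  have h1 := congrArg (fun q => coeff q 1) hexp
  have h3 := congrArg (fun q => coeff q (2 * n + 1 + 2)) hexp
  simp only [coeff_add, coeff_C_mul] at h1 h3
  rw [coeff_X_pow_mul, hQ.coeff_self, hP.coeff_of_lt (by omega), hP.coeff_self, hlead] at h3
  rw [coeff_X_pow_mul', if_neg (by norm_num)] at h1
  have hγ := (hP.2.1 (2 * n + 3)).ne'
  field_simp
  linear_combination -(P (2 * n + 3)).leadingCoeff * D * h1
    + D * (P (2 * n + 3)).coeff 1 * h3 - (P (2 * n + 3)).leadingCoeff * hβ

end SquareModification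

section Measure

variable (μ : Measure ℝ)

/-- Integration of polynomials against a measure with finite moments. -/
def momentFunctional (hint : ∀ p : ℝ[X], Integrable (fun x => p.eval x) μ) : ℝ[X] →ₗ[ℝ] ℝ where
  toFun p := ∫ x, p.eval x ∂μ
  map_add' p q := by simp [integral_add (hint p) (hint q)]
  map_smul' c p := by simp [integral_const_mul]

variable {μ}

lemma momentFunctional_comp_neg (hint : ∀ p : ℝ[X], Integrable (fun x => p.eval x) μ)
    (hsym : μ.map (fun x => -x) = μ) (r : ℝ[X]) :
    momentFunctional μ hint (r.comp (-X)) = momentFunctional μ hint r := by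
  change ∫ x, (r.comp (-X)).eval x ∂μ = ∫ x, r.eval x ∂μ
  conv_rhs => rw [← hsym]
  rw [integral_map (by fun_prop) (by fun_prop)]
  simp

lemma IsOPS.isFunctionalOPS {Q : ℕ → ℝ[X]} {j : ℕ}
    (hint : ∀ p : ℝ[X], Integrable (fun x => p.eval x) μ) (h : IsOPS (muMod μ 0 (2 * j)) Q) :
    IsFunctionalOPS (momentFunctional μ hint ∘ₗ LinearMap.mulLeft ℝ (X ^ (2 * j))) Q := by
  refine ⟨h.1, h.2.1, fun n m => ?_⟩
  rw [← h.2.2 n m, muMod, integral_withDensity_eq_integral_toReal_smul (by fun_prop) (by simp)]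
  refine integral_congr_ae (ae_of_all _ fun x => ?_)
  have : 0 ≤ x ^ (2 * j) := (even_two_mul j).pow_nonneg x
  simp [ENNReal.toReal_ofReal this]

lemma muMod_zero : muMod μ 0 0 = μ := by
  simp [muMod]

end Measure

section RegularVariation

/-- `v n` is asymptotic to `V (n + 1) ^ s`. -/
def HasPowerAsymptotics (v : ℕ → ℝ) (s V : ℝ) : Prop :=
  Tendsto (fun n : ℕ => v n / ((n : ℝ) + 1) ^ s) atTop (𝓝 V)

namespace HasPowerAsymptotics

variable {u v : ℕ → ℝ} {s t U V : ℝ}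

lemma mul (hu : HasPowerAsymptotics u s U) (hv : HasPowerAsymptotics v t V) :
    HasPowerAsymptotics (fun n => u n * v n) (s + t) (U * V) := by
  refine (Tendsto.mul hu hv).congr fun n => ?_
  rw [Real.rpow_add (by positivity), div_mul_div_comm]

lemma pow (hu : HasPowerAsymptotics u s U) (k : ℕ) :
    HasPowerAsymptotics (fun n => u n ^ k) (k * s) (U ^ k) := by
  refine (Tendsto.pow hu k).congr fun n => ?_
  rw [div_pow, mul_comm (k : ℝ), Real.rpow_mul_natCast (by positivity)]

lemma mul_tendsto (hu : HasPowerAsymptotics u s U) (hv : Tendsto v atTop (𝓝 V)) :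
    HasPowerAsymptotics (fun n => v n * u n) s (V * U) := by
  refine (Tendsto.mul hv hu).congr fun n => ?_
  rw [mul_div_assoc]

lemma tendsto_natCast_div_add_one : Tendsto (fun n : ℕ => (n : ℝ) / ((n : ℝ) + 1)) atTop (𝓝 1) := by
  have := tendsto_one_div_add_atTop_nhds_zero_nat (𝕜 := ℝ)
  have h2 := (tendsto_const_nhds (x := (1 : ℝ))).sub this
  rw [sub_zero] at h2
  refine h2.congr fun n => ?_
  field_simp
  ring

lemma of_tendsto_div (h : Tendsto (fun n : ℕ => v n / (V * (n : ℝ) ^ s)) atTop (𝓝 1))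
    (hV : 0 < V) : HasPowerAsymptotics v s V := by
  have h1 := (tendsto_natCast_div_add_one.rpow_const (p := s) (Or.inl one_ne_zero)).const_mul V
  rw [Real.one_rpow] at h1
  have h2 := h.mul h1
  rw [one_mul, mul_one] at h2
  refine h2.congr' ?_
  filter_upwards [eventually_gt_atTop 0] with n hn
  have hn' : (0 : ℝ) < n := by exact_mod_cast hn
  have := Real.rpow_pos_of_pos hn' s
  rw [Real.div_rpow hn'.le (by positivity)]
  field_simp

lemma tendsto_succ_div (hv : HasPowerAsymptotics v s V) (hV : 0 < V) :
    Tendsto (fun n => v (n + 1) / v n) atTop (𝓝 1) := by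
  have h1 := (tendsto_natCast_div_add_one.rpow_const (p := s) (Or.inl one_ne_zero)).inv₀
    (by simp)
  rw [Real.one_rpow, inv_one] at h1
  have h2 := ((hv.comp (tendsto_add_atTop_nat 1)).div hv hV.ne').mul
    (h1.comp (tendsto_add_atTop_nat 1))
  rw [div_self hV.ne', mul_one] at h2
  refine h2.congr fun n => ?_
  have h3 : (0 : ℝ) < ((n : ℝ) + 1) ^ s := by positivity
  have h4 : (0 : ℝ) < ((n : ℝ) + 1 + 1) ^ s := by positivity
  simp only [Function.comp, Pi.div_apply]
  push_cast
  rw [Real.div_rpow (by positivity) (by positivity)]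
  field_simp

lemma exists_le_mul (hv : HasPowerAsymptotics v s V) (hV : 0 < V) (hpos : ∀ n, 0 < v n)
    (hs : 0 < s) : ∃ M, 0 < M ∧ ∀ k n, k ≤ n → v k ≤ M * v n := by
  obtain ⟨C, hC⟩ := hv.bddAbove_range
  obtain ⟨C', hC'⟩ := (hv.inv₀ hV.ne').bddAbove_range
  have h1 : ∀ n : ℕ, v n ≤ C * ((n : ℝ) + 1) ^ s := fun n =>
    (div_le_iff₀ (by positivity)).1 (hC ⟨n, rfl⟩)
  have h2 : ∀ n : ℕ, ((n : ℝ) + 1) ^ s ≤ C' * v n := fun n => by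
    have : (v n / ((n : ℝ) + 1) ^ s)⁻¹ ≤ C' := hC' ⟨n, rfl⟩
    rwa [inv_div, div_le_iff₀ (hpos n)] at this
  have hC0 : 0 < C := by
    have := (hpos 0).trans_le (h1 0)
    simpa using this
  have hC0' : 0 < C' := by
    have : 0 < C' * v 0 := lt_of_lt_of_le (by positivity) (h2 0)
    exact pos_of_mul_pos_left this (hpos 0).le
  refine ⟨C * C', by positivity, fun k n hkn => ?_⟩
  calc v k ≤ C * ((k : ℝ) + 1) ^ s := h1 k
    _ ≤ C * ((n : ℝ) + 1) ^ s := by gcongr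
    _ ≤ C * (C' * v n) := by gcongr; exact h2 n
    _ = C * C' * v n := by ring

lemma tendsto_rpow_sub (s : ℝ) : Tendsto
    (fun n : ℕ => (((n : ℝ) + 1) ^ (s + 1) - (n : ℝ) ^ (s + 1)) / ((n : ℝ) + 1) ^ s)
    atTop (𝓝 (s + 1)) := by
  have h := (Real.hasDerivAt_rpow_const (x := 1) (p := s + 1) (Or.inl one_ne_zero))
  rw [hasDerivAt_iff_tendsto_slope] at h
  simp only [add_sub_cancel_right, Real.one_rpow, mul_one] at h
  have h2 : Tendsto (fun n : ℕ => (n : ℝ) / ((n : ℝ) + 1)) atTop (𝓝[≠] 1) := by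
    refine tendsto_nhdsWithin_iff.2 ⟨tendsto_natCast_div_add_one, Eventually.of_forall fun n => ?_⟩
    have : (n : ℝ) / ((n : ℝ) + 1) < 1 := by
      rw [div_lt_one (by positivity)]
      linarith
    exact this.ne
  refine (h.comp h2).congr fun n => ?_
  have hn : (0 : ℝ) < (n : ℝ) + 1 := by positivity
  have hp := Real.rpow_pos_of_pos hn s
  simp only [Function.comp, slope_def_field, Real.one_rpow]
  rw [Real.div_rpow (by positivity) hn.le, Real.rpow_add_one hn.ne',
    show (n : ℝ) / ((n : ℝ) + 1) - 1 = -1 / ((n : ℝ) + 1) by field_simp; ring]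
  field_simp
  ring

lemma sum_range_succ (hv : HasPowerAsymptotics v s V) (hs : -1 < s) :
    HasPowerAsymptotics (fun n => ∑ k ∈ Finset.range (n + 1), v k) (s + 1) (V / (s + 1)) := by
  have hs1 : 0 < s + 1 := by linarith
  set d : ℕ → ℝ := fun n => ((n : ℝ) + 1) ^ (s + 1) - (n : ℝ) ^ (s + 1) with hd
  have hdpos : ∀ n, 0 < d n := fun n => by
    have : (n : ℝ) ^ (s + 1) < ((n : ℝ) + 1) ^ (s + 1) := by
      apply Real.rpow_lt_rpow (by positivity) (by linarith) hs1
    simp only [hd]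
    linarith
  have hsum : ∀ n : ℕ, ∑ k ∈ Finset.range n, d k = (n : ℝ) ^ (s + 1) := fun n => by
    have := Finset.sum_range_sub (fun k : ℕ => (k : ℝ) ^ (s + 1)) n
    simpa [hd, Real.zero_rpow hs1.ne'] using this
  have hratio : Tendsto (fun n => v n / d n) atTop (𝓝 (V / (s + 1))) := by
    refine (hv.div (tendsto_rpow_sub s) hs1.ne').congr fun n => ?_
    have := hdpos n
    have hp : (0 : ℝ) < ((n : ℝ) + 1) ^ s := by positivity
    simp only [Pi.div_apply]
    change v n / ((n : ℝ) + 1) ^ s / (d n / ((n : ℝ) + 1) ^ s) = _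
    field_simp
  have hlittle : (fun n => v n - V / (s + 1) * d n) =o[atTop] d := by
    rw [Asymptotics.isLittleO_iff_tendsto' (Eventually.of_forall fun n h => absurd h (hdpos n).ne')]
    have := hratio.sub_const (V / (s + 1))
    rw [sub_self] at this
    refine this.congr fun n => ?_
    have := (hdpos n).ne'
    field_simp
  have hsumlittle := hlittle.sum_range (fun n => (hdpos n).le) (by
    simp only [hsum]
    exact (tendsto_rpow_atTop hs1).comp tendsto_natCast_atTop_atTop)
  have h := (hsumlittle.tendsto_div_nhds_zero).comp (tendsto_add_atTop_nat 1)
  have h' := h.add_const (V / (s + 1))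
  rw [zero_add] at h'
  refine h'.congr fun n => ?_
  have hp : (0 : ℝ) < ((n : ℝ) + 1) ^ (s + 1) := by positivity
  simp only [Function.comp, Finset.sum_sub_distrib, ← Finset.mul_sum, hsum]
  push_cast
  field_simp
  ring

/-- Weighted Cesàro means with regularly varying weights. -/
lemma tendsto_weighted_mean {x : ℕ → ℝ} {l : ℝ} (hv : HasPowerAsymptotics v s V) (hV : 0 < V)
    (hs : -1 < s) (hx : Tendsto x atTop (𝓝 l)) :
    Tendsto (fun n : ℕ => (∑ k ∈ Finset.range (n + 1), x k * v k) / (((n : ℝ) + 1) * v n))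
      atTop (𝓝 (l / (s + 1))) := by
  have h := ((hv.mul_tendsto hx).sum_range_succ hs).div hv hV.ne'
  rw [show l * V / (s + 1) / V = l / (s + 1) by field_simp] at h
  refine h.congr fun n => ?_
  have hn : (0 : ℝ) < (n : ℝ) + 1 := by positivity
  have hp := Real.rpow_pos_of_pos hn s
  simp only [Pi.div_apply]
  rw [Real.rpow_add_one hn.ne', div_div_div_eq, mul_comm (∑ k ∈ _, _), mul_assoc,
    mul_div_mul_left _ _ hp.ne']

end HasPowerAsymptotics

end RegularVariation

section PowerSeries

variable {c : ℕ → ℂ}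

lemma summable_norm_of_forall_bound (hc : ∀ R : ℝ, 0 < R → ∃ C, ∀ m, ‖c m‖ * R ^ m ≤ C)
    {R : ℝ} (hR : 0 < R) : Summable fun m => ‖c m‖ * R ^ m := by
  obtain ⟨C, hC⟩ := hc (2 * R) (by positivity)
  refine Summable.of_nonneg_of_le (fun m => by positivity) (fun m => ?_)
    (summable_geometric_two.mul_left C)
  have := hC m
  rw [mul_pow] at this
  rw [one_div, inv_pow, ← div_eq_mul_inv, le_div_iff₀ (by positivity)]
  linarith

lemma summable_of_forall_bound (hc : ∀ R : ℝ, 0 < R → ∃ C, ∀ m, ‖c m‖ * R ^ m ≤ C) (z : ℂ) :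
    Summable fun m => c m * z ^ m := by
  refine Summable.of_norm_bounded (summable_norm_of_forall_bound hc (R := ‖z‖ + 1) (by positivity))
    fun m => ?_
  rw [norm_mul, norm_pow]
  gcongr
  linarith

/-- Cauchy's estimate for the coefficients of an everywhere convergent power series. -/
lemma norm_coeff_mul_pow_le (hc : ∀ R : ℝ, 0 < R → ∃ C, ∀ m, ‖c m‖ * R ^ m ≤ C) {R C : ℝ}
    (hR : 0 < R) (hC : ∀ z : ℂ, ‖z‖ = R → ‖∑' m, c m * z ^ m‖ ≤ C) (m : ℕ) :
    ‖c m‖ * R ^ m ≤ C := by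
  have hrad : (FormalMultilinearSeries.ofScalars ℂ c).radius = ⊤ := by
    refine ENNReal.eq_top_of_forall_nnreal_le fun r => ?_
    obtain ⟨C, hC⟩ := hc (r + 1) (by positivity)
    refine FormalMultilinearSeries.le_radius_of_bound _ C fun n => ?_
    rw [FormalMultilinearSeries.ofScalars_norm]
    refine le_trans ?_ (hC n)
    gcongr
    linarith
  have hps := (FormalMultilinearSeries.ofScalars ℂ c).hasFPowerSeriesOnBall
    (by rw [hrad]; exact ENNReal.zero_lt_top)
  rw [hrad] at hps
  have hsum : (FormalMultilinearSeries.ofScalars ℂ c).sum = fun z => ∑' m, c m * z ^ m := by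
    funext z
    exact FormalMultilinearSeries.ofScalars_sum_eq (E := ℂ) c z
  rw [hsum] at hps
  have hdiff : Differentiable ℂ fun z => ∑' m, c m * z ^ m := by
    have := hps.differentiableOn
    rwa [Metric.eball_top, differentiableOn_univ] at this
  have hcauchy := Complex.norm_iteratedDeriv_le_of_forall_mem_sphere_norm_le (c := 0) m hR
    hdiff.diffContOnCl (fun z hz => hC z (by simpa using hz))
  have hfac := hps.factorial_smul 1 m
  rw [← iteratedDeriv_eq_iteratedFDeriv] at hfac
  rw [← hfac] at hcauchy
  simp only [FormalMultilinearSeries.ofScalars_apply_eq, one_pow, smul_eq_mul, mul_one,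
    nsmul_eq_mul, norm_mul, Complex.norm_natCast] at hcauchy
  rw [le_div_iff₀ (by positivity), mul_assoc] at hcauchy
  exact le_of_mul_le_mul_left hcauchy (by positivity)

end PowerSeries

section ScaledCoefficients

/-- The Taylor coefficients of `z ↦ (-1)^n (u n)⁻¹ F_n(z / b n)`. -/
def scaledCoeff (u b : ℕ → ℝ) (F : ℕ → ℝ[X]) (n m : ℕ) : ℝ :=
  (-1) ^ n * (F n).coeff m / (u n * b n ^ m)

/-- Convergence of the scaled polynomials, expressed through their Taylor coefficients. -/
structure HasScaledLimit (u b : ℕ → ℝ) (F : ℕ → ℝ[X]) (l : ℕ → ℝ) : Prop where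
  tendsto : ∀ m, Tendsto (fun n => scaledCoeff u b F n m) atTop (𝓝 (l m))
  bound : ∀ R : ℝ, 0 < R → ∃ C, ∀ n m, |scaledCoeff u b F n m| * R ^ m ≤ C

variable {u b : ℕ → ℝ} {F : ℕ → ℝ[X]} {l : ℕ → ℝ}

lemma scaledCoeff_eq_zero {n m : ℕ} (hm : (F n).natDegree < m) : scaledCoeff u b F n m = 0 := by
  simp [scaledCoeff, coeff_eq_zero_of_natDegree_lt hm]

lemma scaledCoeff_bound_single (n : ℕ) (R : ℝ) :
    ∃ C, ∀ m, |scaledCoeff u b F n m| * R ^ m ≤ C := by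
  obtain ⟨C, hC⟩ := ((Finset.range ((F n).natDegree + 1)).image
    fun m => |scaledCoeff u b F n m| * R ^ m).bddAbove
  refine ⟨max C 0, fun m => ?_⟩
  by_cases hm : m < (F n).natDegree + 1
  · refine le_max_of_le_left (hC ?_)
    simp only [Finset.coe_image, Set.mem_image, Finset.coe_range, Set.mem_Iio]
    exact ⟨m, hm, rfl⟩
  · rw [scaledCoeff_eq_zero (by omega)]
    simp

lemma scaled_aeval_eq_tsum (n : ℕ) (z : ℂ) :
    (((-1 : ℝ) ^ n * (u n)⁻¹ : ℝ) : ℂ) * aeval (z / (b n : ℂ)) (F n)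
      = ∑' m, (scaledCoeff u b F n m : ℂ) * z ^ m := by
  rw [tsum_eq_sum (s := Finset.range ((F n).natDegree + 1)) (fun m hm => by
    rw [scaledCoeff_eq_zero (by simpa using hm)]; simp), aeval_eq_sum_range, Finset.mul_sum]
  refine Finset.sum_congr rfl fun m _ => ?_
  simp only [scaledCoeff, Complex.real_smul]
  push_cast
  rw [div_pow]
  ring

lemma HasScaledLimit.bound_limit (h : HasScaledLimit u b F l) {R C : ℝ}
    (hC : ∀ n m, |scaledCoeff u b F n m| * R ^ m ≤ C) (m : ℕ) : |l m| * R ^ m ≤ C :=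
  le_of_tendsto ((h.tendsto m).abs.mul_const _) (Eventually.of_forall fun n => hC n m)

lemma HasScaledLimit.tendstoUniformlyOn (h : HasScaledLimit u b F l) {K : Set ℂ}
    (hK : IsCompact K) :
    TendstoUniformlyOn
      (fun (n : ℕ) (z : ℂ) => (((-1 : ℝ) ^ n * (u n)⁻¹ : ℝ) : ℂ) * aeval (z / (b n : ℂ)) (F n))
      (fun z => ∑' m, (l m : ℂ) * z ^ m) atTop K := by
  obtain ⟨R, hR, hKR⟩ := hK.isBounded.exists_pos_norm_le
  obtain ⟨C, hC⟩ := h.bound (2 * R) (by positivity)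
  have hCl := h.bound_limit hC
  have hbd : ∀ n m, ‖|l m - scaledCoeff u b F n m| * R ^ m‖ ≤ 2 * C * (1 / 2) ^ m := by
    intro n m
    have h1 := hC n m
    have h2 := hCl m
    have h3 : |l m - scaledCoeff u b F n m| * (2 * R) ^ m ≤ 2 * C := by
      calc _ ≤ (|l m| + |scaledCoeff u b F n m|) * (2 * R) ^ m := by gcongr; exact abs_sub _ _
        _ ≤ 2 * C := by linarith
    rw [Real.norm_of_nonneg (by positivity), one_div, inv_pow, ← div_eq_mul_inv,
      le_div_iff₀ (by positivity)]
    rw [mul_pow] at h3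
    linarith
  have hgeo : Summable fun m : ℕ => 2 * C * (1 / 2 : ℝ) ^ m := summable_geometric_two.mul_left _
  have hzero : Tendsto (fun n => ∑' m, |l m - scaledCoeff u b F n m| * R ^ m) atTop (𝓝 0) := by
    have := tendsto_tsum_of_dominated_convergence (𝓕 := atTop) hgeo (g := fun _ => (0 : ℝ))
      (fun m => ?_) (Eventually.of_forall fun n => hbd n)
    · simpa using this
    · have := (((h.tendsto m).const_sub (l m)).abs).mul_const (R ^ m)
      simpa using this
  have hsl : ∀ z : ℂ, Summable fun m => (l m : ℂ) * z ^ m :=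
    summable_of_forall_bound fun R hR => by
      obtain ⟨C, hC⟩ := h.bound R hR
      exact ⟨C, fun m => by simpa using h.bound_limit hC m⟩
  have hsx : ∀ n (z : ℂ), Summable fun m => (scaledCoeff u b F n m : ℂ) * z ^ m := fun n =>
    summable_of_forall_bound fun R hR => by
      obtain ⟨C, hC⟩ := h.bound R hR
      exact ⟨C, fun m => by simpa using hC n m⟩
  rw [Metric.tendstoUniformlyOn_iff]
  intro ε hε
  filter_upwards [hzero.eventually_lt_const hε] with n hn z hz
  refine lt_of_le_of_lt ?_ hn
  rw [scaled_aeval_eq_tsum, dist_eq_norm, ← (hsl z).tsum_sub (hsx n z)]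
  refine tsum_of_norm_bounded (Summable.of_norm_bounded hgeo (hbd n)).hasSum fun m => ?_
  rw [← sub_mul, norm_mul, norm_pow, ← Complex.ofReal_sub, Complex.norm_real, Real.norm_eq_abs]
  gcongr
  exact hKR z hz

lemma HasScaledLimit.of_tendstoUniformlyOn
    (hl : ∀ R : ℝ, 0 < R → ∃ C, ∀ m, |l m| * R ^ m ≤ C)
    (h : ∀ K : Set ℂ, IsCompact K → TendstoUniformlyOn
      (fun (n : ℕ) (z : ℂ) => (((-1 : ℝ) ^ n * (u n)⁻¹ : ℝ) : ℂ) * aeval (z / (b n : ℂ)) (F n))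
      (fun z => ∑' m, (l m : ℂ) * z ^ m) atTop K) :
    HasScaledLimit u b F l := by
  have key : ∀ R : ℝ, 0 < R → ∀ ε, 0 < ε →
      ∀ᶠ n in atTop, ∀ m, |scaledCoeff u b F n m - l m| * R ^ m ≤ ε := by
    intro R hR ε hε
    filter_upwards [Metric.tendstoUniformlyOn_iff.1 (h _ (isCompact_sphere (0 : ℂ) R)) ε hε]
      with n hn m
    have hsx : ∀ R : ℝ, 0 < R → ∃ C, ∀ m, ‖(scaledCoeff u b F n m : ℂ)‖ * R ^ m ≤ C := by
      intro R _
      obtain ⟨C, hC⟩ := scaledCoeff_bound_single (u := u) (b := b) (F := F) n R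
      exact ⟨C, fun m => by simpa using hC m⟩
    have hsl : ∀ R : ℝ, 0 < R → ∃ C, ∀ m, ‖(l m : ℂ)‖ * R ^ m ≤ C := by
      intro R hR
      obtain ⟨C, hC⟩ := hl R hR
      exact ⟨C, fun m => by simpa using hC m⟩
    have := norm_coeff_mul_pow_le (c := fun m => (scaledCoeff u b F n m : ℂ) - (l m : ℂ))
      (R := R) (C := ε) (fun R hR => ?_) hR (fun z hz => ?_) m
    · rwa [← Complex.ofReal_sub, Complex.norm_real, Real.norm_eq_abs] at this
    · obtain ⟨C, hC⟩ := hsx R hR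
      obtain ⟨C', hC'⟩ := hsl R hR
      refine ⟨C + C', fun m => ?_⟩
      calc _ ≤ (‖(scaledCoeff u b F n m : ℂ)‖ + ‖(l m : ℂ)‖) * R ^ m := by
            gcongr; exact norm_sub_le _ _
        _ ≤ C + C' := by linarith [hC m, hC' m]
    · have := hn z (by simpa using hz)
      rw [scaled_aeval_eq_tsum, dist_comm, dist_eq_norm,
        ← (summable_of_forall_bound hsx z).tsum_sub (summable_of_forall_bound hsl z)] at this
      simp only [← sub_mul] at this
      exact this.le
  refine ⟨fun m => ?_, fun R hR => ?_⟩
  · rw [Metric.tendsto_atTop']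
    intro ε hε
    obtain ⟨N, hN⟩ := eventually_atTop.1 (key 1 one_pos (ε / 2) (by positivity))
    refine ⟨N, fun n hn => ?_⟩
    have := hN n hn.le m
    rw [one_pow, mul_one] at this
    rw [Real.dist_eq]
    linarith
  · obtain ⟨N, hN⟩ := eventually_atTop.1 (key R hR 1 one_pos)
    obtain ⟨C, hC⟩ := hl R hR
    choose D hD using fun n => scaledCoeff_bound_single (u := u) (b := b) (F := F) n R
    obtain ⟨E, hE⟩ := ((Finset.range N).image D).bddAbove
    refine ⟨max E (1 + C), fun n m => ?_⟩
    by_cases hn : n < N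
    · refine le_max_of_le_left ((hD n m).trans (hE ?_))
      simp only [Finset.coe_image, Set.mem_image, Finset.coe_range, Set.mem_Iio]
      exact ⟨n, hn, rfl⟩
    · refine le_max_of_le_right ?_
      calc |scaledCoeff u b F n m| * R ^ m
          ≤ (|scaledCoeff u b F n m - l m| + |l m|) * R ^ m := by
            gcongr
            linarith [abs_sub_abs_le_abs_sub (scaledCoeff u b F n m) (l m)]
        _ ≤ 1 + C := by linarith [hN n (by omega) m, hC m]

end ScaledCoefficients

section BesselCoefficients

/-- The Taylor coefficients of `phi ν`. -/
def phiCoeff (ν : ℝ) (m : ℕ) : ℝ :=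
  if Even m then (-1) ^ (m / 2) / ((m / 2).factorial * Real.Gamma ((m / 2 : ℕ) + ν + 1)) else 0

/-- The Taylor coefficients of `z ↦ z * phi ν z`. -/
def oddPhiCoeff (ν : ℝ) : ℕ → ℝ
  | 0 => 0
  | m + 1 => phiCoeff ν m

variable {ν : ℝ}

lemma phiCoeff_two_mul (k : ℕ) :
    phiCoeff ν (2 * k) = (-1) ^ k / (k.factorial * Real.Gamma (k + ν + 1)) := by
  simp [phiCoeff]

lemma phiCoeff_of_odd {m : ℕ} (hm : ¬ Even m) : phiCoeff ν m = 0 := if_neg hm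

lemma phi_eq_tsum (ν : ℝ) (z : ℂ) : phi ν z = ∑' m, (phiCoeff ν m : ℂ) * z ^ m := by
  have hinj : Function.Injective (fun k : ℕ => 2 * k) := fun a b h => by
    simpa using h
  rw [phi, ← hinj.tsum_eq (f := fun m => (phiCoeff ν m : ℂ) * z ^ m)]
  · refine tsum_congr fun k => ?_
    rw [phiCoeff_two_mul]
    push_cast
    rw [← Complex.Gamma_ofReal]
    push_cast
    ring
  · intro m hm
    by_contra hm'
    refine hm ?_
    dsimp only
    rw [phiCoeff_of_odd]
    · simp
    · rintro ⟨k, rfl⟩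
      exact hm' ⟨k, by ring⟩

lemma exists_inv_Gamma_le (hν : -1 < ν) : ∃ C, ∀ k : ℕ, (Real.Gamma (k + ν + 1))⁻¹ ≤ C := by
  have h : ∀ k : ℕ, (Real.Gamma ((k + 1 : ℕ) + ν + 1))⁻¹ ≤ (Real.Gamma (ν + 2))⁻¹ := by
    intro k
    induction k with
    | zero => exact le_of_eq (by push_cast; ring_nf)
    | succ k ih =>
      refine le_trans ?_ ih
      have hpos : 0 < ((k + 1 : ℕ) : ℝ) + ν + 1 := by push_cast; linarith [k.cast_nonneg (α := ℝ)]
      rw [show (((k + 1 + 1 : ℕ) : ℝ) + ν + 1) = (((k + 1 : ℕ) : ℝ) + ν + 1) + 1 by push_cast; ring,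
        Real.Gamma_add_one hpos.ne']
      have hG := Real.Gamma_pos_of_pos hpos
      refine inv_anti₀ hG (le_mul_of_one_le_left hG.le ?_)
      push_cast
      linarith [k.cast_nonneg (α := ℝ)]
  refine ⟨max (Real.Gamma (ν + 1))⁻¹ (Real.Gamma (ν + 2))⁻¹, fun k => ?_⟩
  cases k with
  | zero => simp
  | succ k => exact le_max_of_le_right (h k)

lemma phiCoeff_bound (hν : -1 < ν) (R : ℝ) (hR : 0 < R) :
    ∃ C, ∀ m, |phiCoeff ν m| * R ^ m ≤ C := by
  obtain ⟨C, hC⟩ := exists_inv_Gamma_le hν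
  obtain ⟨D, hD⟩ := (Real.summable_pow_div_factorial (R ^ 2)).tendsto_atTop_zero.bddAbove_range
  have hD' : ∀ k : ℕ, (R ^ 2) ^ k / k.factorial ≤ D := fun k => hD ⟨k, rfl⟩
  have hG : ∀ k : ℕ, 0 < Real.Gamma (k + ν + 1) := fun k =>
    Real.Gamma_pos_of_pos (by linarith [k.cast_nonneg (α := ℝ)])
  have hC0 : 0 ≤ C := (inv_nonneg.2 (hG 0).le).trans (hC 0)
  have hD0 : 0 ≤ D := le_trans (by positivity) (hD' 0)
  refine ⟨C * D, fun m => ?_⟩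
  by_cases hm : Even m
  · obtain ⟨k, rfl⟩ := hm
    rw [← two_mul, phiCoeff_two_mul, abs_div, abs_pow, abs_neg, abs_one, one_pow,
      abs_of_pos (mul_pos (by positivity) (hG k)), pow_mul]
    calc _ = (Real.Gamma (k + ν + 1))⁻¹ * ((R ^ 2) ^ k / k.factorial) := by
          rw [one_div, mul_inv]; ring
      _ ≤ C * D := mul_le_mul (hC k) (hD' k) (by positivity) hC0
  · rw [phiCoeff_of_odd hm]
    simpa using mul_nonneg hC0 hD0

lemma oddPhiCoeff_bound (hν : -1 < ν) (R : ℝ) (hR : 0 < R) :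
    ∃ C, ∀ m, |oddPhiCoeff ν m| * R ^ m ≤ C := by
  obtain ⟨C, hC⟩ := phiCoeff_bound hν R hR
  have hC0 : 0 ≤ C := le_trans (by positivity) (hC 0)
  refine ⟨C * R, fun m => ?_⟩
  cases m with
  | zero => simpa [oddPhiCoeff] using mul_nonneg hC0 hR.le
  | succ m =>
    rw [oddPhiCoeff, pow_succ, ← mul_assoc]
    gcongr
    exact hC m

lemma mul_phi_eq_tsum (hν : -1 < ν) (z : ℂ) :
    z * phi ν z = ∑' m, (oddPhiCoeff ν m : ℂ) * z ^ m := by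
  have hs : Summable fun m => (oddPhiCoeff ν m : ℂ) * z ^ m :=
    summable_of_forall_bound (fun R hR => by simpa using oddPhiCoeff_bound hν R hR) z
  rw [hs.tsum_eq_zero_add, phi_eq_tsum, ← tsum_mul_left]
  simp only [oddPhiCoeff, Complex.ofReal_zero, zero_mul, zero_add]
  exact tsum_congr fun m => by ring

lemma oddPhiCoeff_add_one (hν : -1 < ν) (m : ℕ) :
    oddPhiCoeff (ν + 1) m = 2 * oddPhiCoeff ν m / (2 * ν + m + 1) := by
  cases m with
  | zero => simp [oddPhiCoeff]
  | succ m =>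
    simp only [oddPhiCoeff]
    by_cases hm : Even m
    · obtain ⟨k, rfl⟩ := hm
      have hpos : 0 < (k : ℝ) + ν + 1 := by linarith [k.cast_nonneg (α := ℝ)]
      have hG := (Real.Gamma_pos_of_pos hpos).ne'
      rw [← two_mul, phiCoeff_two_mul, phiCoeff_two_mul,
        show (k : ℝ) + (ν + 1) + 1 = (k + ν + 1) + 1 by ring, Real.Gamma_add_one hpos.ne']
      push_cast
      rw [show 2 * ν + (2 * (k : ℝ) + 1) + 1 = 2 * (k + ν + 1) by ring]
      field_simp
    · rw [phiCoeff_of_odd hm, phiCoeff_of_odd hm]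
      simp

lemma oddPhiCoeff_one_pos (hν : -1 < ν) : 0 < oddPhiCoeff ν 1 := by
  have := Real.Gamma_pos_of_pos (show 0 < ν + 1 by linarith)
  simpa [oddPhiCoeff, phiCoeff] using this

end BesselCoefficients

section Induction

/-- Mehler–Heine asymptotics of the odd-degree polynomials, with the growth of their leading
coefficients. -/
structure HasOddAsymptotics (u b : ℕ → ℝ) (β ν : ℝ) (P : ℕ → ℝ[X]) : Prop where
  limit : HasScaledLimit u b (fun n => P (2 * n + 1)) (oddPhiCoeff ν)
  ratio : Tendsto (fun n : ℕ => (P (2 * n + 1)).leadingCoeff / (P (2 * n + 3)).leadingCoeff *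
    (b n / ((n : ℝ) + 1)) ^ 2) atTop (𝓝 (1 / (2 * β) ^ 2))

lemma coeff_eq_scaledCoeff {u b : ℕ → ℝ} (F : ℕ → ℝ[X]) (hu : ∀ n, 0 < u n) (hb : ∀ n, 0 < b n)
    (n m : ℕ) : (F n).coeff m = (-1) ^ n * scaledCoeff u b F n m * (u n * b n ^ m) := by
  have h1 : (-1 : ℝ) ^ n * (-1) ^ n = 1 := by rw [← mul_pow]; simp
  have h2 := (hu n).ne'
  have h3 := (hb n).ne'
  rw [scaledCoeff, mul_assoc, div_mul_cancel₀ _ (by positivity), ← mul_assoc, h1, one_mul]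

variable {L L' : ℝ[X] →ₗ[ℝ] ℝ} {P Q : ℕ → ℝ[X]} {u b : ℕ → ℝ} {α β ν U B : ℝ}

lemma HasScaledLimit.even_of_odd (hL : ∀ r : ℝ[X], L (r.comp (-X)) = L r)
    (hLL : ∀ r, L' r = L (X ^ 2 * r)) (hP : IsFunctionalOPS L P) (hQ : IsFunctionalOPS L' Q)
    (h : HasScaledLimit u b (fun n => P (2 * n + 1)) (oddPhiCoeff ν)) :
    HasScaledLimit (fun n => u n * b n) b (fun n => Q (2 * n)) (phiCoeff ν) := by
  have hc : ∀ n m, scaledCoeff (fun n => u n * b n) b (fun n => Q (2 * n)) n m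
      = scaledCoeff u b (fun n => P (2 * n + 1)) n (m + 1) := by
    intro n m
    rw [scaledCoeff, scaledCoeff, ← X_mul_even hL hLL hP hQ, coeff_X_mul, pow_succ' (b n),
      mul_assoc (u n)]
  refine ⟨fun m => ?_, fun R hR => ?_⟩
  · simp only [hc]
    exact h.tendsto (m + 1)
  · obtain ⟨C, hC⟩ := h.bound R hR
    refine ⟨C / R, fun n m => ?_⟩
    rw [hc, le_div_iff₀ hR, mul_assoc, ← pow_succ]
    exact hC n (m + 1)

/-- The normalising factor of the kernel, rescaled. -/
def kernelFactor (L : ℝ[X] →ₗ[ℝ] ℝ) (Q : ℕ → ℝ[X]) (u : ℕ → ℝ) (n : ℕ) : ℝ :=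
  (-1) ^ n * L (X * Q (2 * n + 1)) * ((n : ℝ) + 1) * u n

lemma leadingCoeff_eq_kernelFactor (hL : ∀ r : ℝ[X], L (r.comp (-X)) = L r)
    (hLL : ∀ r, L' r = L (X ^ 2 * r)) (hP : IsFunctionalOPS L P) (hQ : IsFunctionalOPS L' Q)
    (hu : ∀ n, 0 < u n) (hb : ∀ n, 0 < b n) (n : ℕ) :
    (Q (2 * n + 1)).leadingCoeff = kernelFactor L Q u n *
      scaledCoeff u b (fun n => P (2 * n + 1)) n 1 * (b n / ((n : ℝ) + 1)) *
      (P (2 * n + 1)).leadingCoeff := by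
  rw [odd_leadingCoeff hL hLL hP hQ, kernelFactor,
    coeff_eq_scaledCoeff (fun n => P (2 * n + 1)) hu hb n 1]
  field_simp

lemma kernelFactor_mul_pos (hL : ∀ r : ℝ[X], L (r.comp (-X)) = L r)
    (hLL : ∀ r, L' r = L (X ^ 2 * r)) (hP : IsFunctionalOPS L P) (hQ : IsFunctionalOPS L' Q)
    (hu : ∀ n, 0 < u n) (hb : ∀ n, 0 < b n) (n : ℕ) :
    0 < kernelFactor L Q u n * scaledCoeff u b (fun n => P (2 * n + 1)) n 1 := by
  have h := hQ.2.1 (2 * n + 1)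
  rw [leadingCoeff_eq_kernelFactor hL hLL hP hQ hu hb] at h
  have hbn := hb n
  exact pos_of_mul_pos_left (pos_of_mul_pos_left h (hP.2.1 _).le) (by positivity)

lemma kernelFactor_sq_mul (hL : ∀ r : ℝ[X], L (r.comp (-X)) = L r)
    (hLL : ∀ r, L' r = L (X ^ 2 * r)) (hP : IsFunctionalOPS L P) (hQ : IsFunctionalOPS L' Q)
    (hu : ∀ n, 0 < u n) (hb : ∀ n, 0 < b n) (n : ℕ) :
    kernelFactor L Q u n ^ 2 * (scaledCoeff u b (fun n => P (2 * n + 1)) n 1 *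
      scaledCoeff u b (fun n => P (2 * n + 1)) (n + 1) 1 * (u (n + 1) / u n) * (b (n + 1) / b n) *
      ((P (2 * n + 1)).leadingCoeff / (P (2 * n + 3)).leadingCoeff *
        (b n / ((n : ℝ) + 1)) ^ 2)) = 1 := by
  have h := odd_normalization hL hLL hP hQ n
  have h2 : (P (2 * n + 3)).coeff 1 = _ :=
    coeff_eq_scaledCoeff (fun n => P (2 * n + 1)) hu hb (n + 1) 1
  have h1 : (-1 : ℝ) ^ n * (-1) ^ n = 1 := by rw [← mul_pow]; simp
  rw [h2, coeff_eq_scaledCoeff (fun n => P (2 * n + 1)) hu hb n 1, pow_succ (-1 : ℝ) n] at h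
  have hun := (hu n).ne'
  have hbn := (hb n).ne'
  have hγ := (hP.2.1 (2 * n + 3)).ne'
  rw [kernelFactor]
  field_simp at h ⊢
  have h4 : (-1 : ℝ) ^ (n * 2) = 1 := by rw [mul_comm, pow_mul]; simp
  simp only [← pow_mul, h4] at h ⊢
  linarith

lemma tendsto_kernelFactor_mul (hL : ∀ r : ℝ[X], L (r.comp (-X)) = L r)
    (hLL : ∀ r, L' r = L (X ^ 2 * r)) (hP : IsFunctionalOPS L P) (hQ : IsFunctionalOPS L' Q)
    (hu : ∀ n, 0 < u n) (hb : ∀ n, 0 < b n)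
    (hua : HasPowerAsymptotics u α U) (hU : 0 < U) (hba : HasPowerAsymptotics b β B) (hB : 0 < B)
    (hβ : 0 < β) (hν : -1 < ν) (h : HasOddAsymptotics u b β ν P) :
    Tendsto (fun n => kernelFactor L Q u n * scaledCoeff u b (fun n => P (2 * n + 1)) n 1)
      atTop (𝓝 (2 * β)) := by
  have hy := h.limit.tendsto 1
  have hy0 := oddPhiCoeff_one_pos hν
  have hz := ((((hy.mul (hy.comp (tendsto_add_atTop_nat 1))).mul
    (hua.tendsto_succ_div hU)).mul (hba.tendsto_succ_div hB)).mul h.ratio).inv₀ (by positivity)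
  have hsq : Tendsto (fun n => Real.sqrt ((kernelFactor L Q u n) ^ 2 *
      (scaledCoeff u b (fun n => P (2 * n + 1)) n 1) ^ 2)) atTop (𝓝 (Real.sqrt ((2 * β) ^ 2))) := by
    have := (hz.mul (hy.pow 2)).sqrt
    rw [show (oddPhiCoeff ν 1 * oddPhiCoeff ν 1 * 1 * 1 * (1 / (2 * β) ^ 2))⁻¹ *
      oddPhiCoeff ν 1 ^ 2 = (2 * β) ^ 2 by field_simp] at this
    refine this.congr fun n => ?_
    rw [eq_inv_of_mul_eq_one_left (kernelFactor_sq_mul hL hLL hP hQ hu hb n)]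
    rfl
  rw [Real.sqrt_sq (by positivity)] at hsq
  refine hsq.congr fun n => ?_
  rw [← mul_pow, Real.sqrt_sq (kernelFactor_mul_pos hL hLL hP hQ hu hb n).le]

lemma scaledCoeff_odd_eq (hL : ∀ r : ℝ[X], L (r.comp (-X)) = L r)
    (hLL : ∀ r, L' r = L (X ^ 2 * r)) (hP : IsFunctionalOPS L P) (hQ : IsFunctionalOPS L' Q)
    (hu : ∀ n, 0 < u n) (hb : ∀ n, 0 < b n) (n m : ℕ) :
    scaledCoeff (fun n => u n * b n) b (fun n => Q (2 * n + 1)) n m = kernelFactor L Q u n *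
      ((∑ k ∈ Finset.range (n + 1), scaledCoeff u b (fun n => P (2 * n + 1)) k 1 *
          scaledCoeff u b (fun n => P (2 * n + 1)) k m * (u k ^ 2 * b k ^ (m + 1))) /
        (((n : ℝ) + 1) * (u n ^ 2 * b n ^ (m + 1)))) := by
  have hsum : ∀ k, (P (2 * k + 1)).coeff 1 * (P (2 * k + 1)).coeff m =
      scaledCoeff u b (fun n => P (2 * n + 1)) k 1 *
          scaledCoeff u b (fun n => P (2 * n + 1)) k m * (u k ^ 2 * b k ^ (m + 1)) := by
    intro k
    have h1 : (-1 : ℝ) ^ k * (-1) ^ k = 1 := by rw [← mul_pow]; simp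
    rw [coeff_eq_scaledCoeff (fun n => P (2 * n + 1)) hu hb k 1,
      coeff_eq_scaledCoeff (fun n => P (2 * n + 1)) hu hb k m]
    linear_combination scaledCoeff u b (fun n => P (2 * n + 1)) k 1 *
          scaledCoeff u b (fun n => P (2 * n + 1)) k m * (u k ^ 2 * b k ^ (m + 1)) * h1
  have hun := (hu n).ne'
  have hbn := (hb n).ne'
  rw [scaledCoeff, odd_eq_kernel hL hLL hP hQ n, coeff_C_mul, finsetSum_coeff]
  simp only [coeff_C_mul, hsum]
  rw [kernelFactor]
  field_simp
  ring

/-- The passage from `x^{2j} dμ` to `x^{2j+2} dμ`. -/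
lemma HasOddAsymptotics.succ (hL : ∀ r : ℝ[X], L (r.comp (-X)) = L r)
    (hLL : ∀ r, L' r = L (X ^ 2 * r)) (hP : IsFunctionalOPS L P) (hQ : IsFunctionalOPS L' Q)
    (hu : ∀ n, 0 < u n) (hb : ∀ n, 0 < b n)
    (hua : HasPowerAsymptotics u α U) (hU : 0 < U) (hba : HasPowerAsymptotics b β B) (hB : 0 < B)
    (hβ : 0 < β) (hν : 0 < ν) (hlink : 2 * α + 1 = 2 * β * ν)
    (h : HasOddAsymptotics u b β ν P) :
    HasOddAsymptotics (fun n => u n * b n) b β (ν + 1) Q := by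
  have hν' : -1 < ν := by linarith
  have hH := tendsto_kernelFactor_mul hL hLL hP hQ hu hb hua hU hba hB hβ hν' h
  have hHpos := kernelFactor_mul_pos hL hLL hP hQ hu hb
  have hy := h.limit.tendsto 1
  have hy0 := oddPhiCoeff_one_pos hν'
  have hG : Tendsto (kernelFactor L Q u) atTop (𝓝 (2 * β / oddPhiCoeff ν 1)) := by
    refine (hH.div hy hy0.ne').congr fun n => ?_
    exact mul_div_cancel_right₀ _ (right_ne_zero_of_mul (hHpos n).ne')
  have hweight : ∀ m : ℕ, HasPowerAsymptotics (fun n => u n ^ 2 * b n ^ (m + 1))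
      (2 * α + (m + 1) * β) (U ^ 2 * B ^ (m + 1)) := fun m => by
    have := (hua.pow 2).mul (hba.pow (m + 1))
    push_cast at this
    exact this
  have hβν : 0 < β * ν := by positivity
  have hexp : ∀ m : ℕ, -1 < 2 * α + (m + 1) * β := fun m => by
    have : 0 < ((m : ℝ) + 1) * β := by positivity
    linarith
  refine ⟨⟨fun m => ?_, fun R hR => ?_⟩, ?_⟩
  · have hmean := hG.mul ((hweight m).tendsto_weighted_mean (by positivity) (hexp m)
      (hy.mul (h.limit.tendsto m)))
    simp only [← scaledCoeff_odd_eq hL hLL hP hQ hu hb] at hmean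
    rw [oddPhiCoeff_add_one hν']
    convert! hmean using 2
    have h1 : 0 < 2 * ν + m + 1 := by positivity
    rw [show 2 * α + (m + 1) * β + 1 = β * (2 * ν + m + 1) by linarith]
    field_simp
  · obtain ⟨M, hM, hMle⟩ := hba.exists_le_mul hB hb hβ
    obtain ⟨C, hC⟩ := h.limit.bound (R * M) (by positivity)
    obtain ⟨C₁, hC₁⟩ := h.limit.bound 1 one_pos
    obtain ⟨C₂, hC₂⟩ := hG.abs.bddAbove_range
    obtain ⟨C₃, hC₃⟩ := ((hweight 0).tendsto_weighted_mean (by positivity) (hexp 0)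
      (tendsto_const_nhds (x := (1 : ℝ)))).bddAbove_range
    have hC0 : 0 ≤ C := le_trans (by positivity) (hC 0 0)
    have hC0₁ : 0 ≤ C₁ := le_trans (by positivity) (hC₁ 0 0)
    have hC0₂ : 0 ≤ C₂ := le_trans (abs_nonneg _) (hC₂ ⟨0, rfl⟩)
    refine ⟨C₂ * (C₁ * C * C₃), fun n m => ?_⟩
    have hun := hu n
    have hbn := hb n
    rw [scaledCoeff_odd_eq hL hLL hP hQ hu hb, abs_mul, mul_assoc]
    refine mul_le_mul (hC₂ ⟨n, rfl⟩) ?_ (by positivity) hC0₂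
    have hC₃n : (∑ k ∈ Finset.range (n + 1), 1 * (u k ^ 2 * b k ^ (0 + 1))) /
        (((n : ℝ) + 1) * (u n ^ 2 * b n ^ (0 + 1))) ≤ C₃ := hC₃ ⟨n, rfl⟩
    have hsum : |∑ k ∈ Finset.range (n + 1), scaledCoeff u b (fun n => P (2 * n + 1)) k 1 *
        scaledCoeff u b (fun n => P (2 * n + 1)) k m * (u k ^ 2 * b k ^ (m + 1))| * R ^ m ≤
        ∑ k ∈ Finset.range (n + 1), C₁ * C * b n ^ m * (1 * (u k ^ 2 * b k ^ (0 + 1))) := by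
      refine (mul_le_mul_of_nonneg_right (Finset.abs_sum_le_sum_abs _ _) (by positivity)).trans ?_
      rw [Finset.sum_mul]
      refine Finset.sum_le_sum fun k hk => ?_
      have huk := hu k
      have hbk := hb k
      have hbkn := hMle k n (by rw [Finset.mem_range] at hk; omega)
      have h1 := hC₁ k 1
      rw [one_pow, mul_one] at h1
      have h2 := hC k m
      rw [mul_pow] at h2
      rw [abs_mul, abs_mul, abs_of_pos (show 0 < u k ^ 2 * b k ^ (m + 1) by positivity)]
      calc _ = |scaledCoeff u b (fun n => P (2 * n + 1)) k 1| *
            (|scaledCoeff u b (fun n => P (2 * n + 1)) k m| * (R ^ m * b k ^ m)) *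
            (u k ^ 2 * b k) := by ring
        _ ≤ C₁ * (|scaledCoeff u b (fun n => P (2 * n + 1)) k m| * (R ^ m * (M * b n) ^ m)) *
            (u k ^ 2 * b k) := by gcongr
        _ = C₁ * (|scaledCoeff u b (fun n => P (2 * n + 1)) k m| * (R ^ m * M ^ m)) *
            (b n ^ m * (u k ^ 2 * b k)) := by ring
        _ ≤ C₁ * C * (b n ^ m * (u k ^ 2 * b k)) := by gcongr
        _ = _ := by ring
    rw [← Finset.mul_sum] at hsum
    rw [div_le_iff₀ (by positivity)] at hC₃n
    rw [abs_div, abs_of_pos (show 0 < ((n : ℝ) + 1) * (u n ^ 2 * b n ^ (m + 1)) by positivity),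
      div_mul_eq_mul_div, div_le_iff₀ (by positivity)]
    calc _ ≤ _ := hsum
      _ ≤ C₁ * C * b n ^ m * (C₃ * (((n : ℝ) + 1) * (u n ^ 2 * b n ^ (0 + 1)))) := by gcongr
      _ = _ := by ring
  · have hr : HasPowerAsymptotics (fun n => b n / ((n : ℝ) + 1)) (β - 1) B := by
      refine Tendsto.congr (fun n => ?_) hba
      rw [Real.rpow_sub_one (by positivity)]
      field_simp
    have hlim := ((hH.div (hH.comp (tendsto_add_atTop_nat 1)) (by positivity)).mul
      ((hr.tendsto_succ_div hB).inv₀ one_ne_zero)).mul h.ratio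
    rw [div_self (by positivity), inv_one, one_mul, one_mul] at hlim
    refine hlim.congr fun n => ?_
    have h3 : (Q (2 * n + 3)).leadingCoeff = _ :=
      leadingCoeff_eq_kernelFactor hL hLL hP hQ hu hb (n + 1)
    rw [h3, leadingCoeff_eq_kernelFactor hL hLL hP hQ hu hb n]
    simp only [Function.comp, Pi.div_apply, inv_div]
    rw [show 2 * (n + 1) + 1 = 2 * n + 3 by ring]
    simp only [div_eq_mul_inv, mul_inv, inv_inv]
    push_cast
    ring

end Induction

/-- **Lemma 4 (symmetric case).** If `μ` is symmetric,
`(-1)^n a_n^{1/2} p_{2n}(z/b_n) → φ_ν(z)` and `(-1)^n a_n^{1/2} p_{2n+1}(z/b_n) → z φ_{ν+1}(z)`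
uniformly on compact sets, with `a_n^{-1/2} ≅ A n^a`, `b_n ≅ B n^b`, `2a+1 = 2b(ν+1)` and
the leading coefficient conditions, then for every `j`,
`(-1)^n (a_n^{1/2}/b_n^j) p_{2n}^{[2j]}(z/b_n) → φ_{ν+j}(z)` and
`(-1)^n (a_n^{1/2}/b_n^j) p_{2n+1}^{[2j]}(z/b_n) → z φ_{ν+j+1}(z)`. -/
theorem symmetric_mehler_heine_all_j
    (μ : Measure ℝ) [IsFiniteMeasure μ]
    (hsupp : (measSupport μ).Infinite)
    (hint : ∀ p : Polynomial ℝ, Integrable (fun x => p.eval x) μ)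
    (hsym : μ.map (fun x => -x) = μ)
    (p : ℕ → Polynomial ℝ) (hp : IsOPS μ p)
    (P : ℕ → ℕ → Polynomial ℝ)
    (hP : ∀ j, IsOPS (muMod μ 0 (2 * j)) (P j))
    (a b : ℕ → ℝ) (ha : ∀ n, 0 < a n) (hb : ∀ n, 0 < b n)
    (A B bexp : ℝ) (aexp : ℝ) (hA : 0 < A) (hB : 0 < B) (hbexp : 0 < bexp)
    (ν : ℝ) (hν : -1 < ν)
    (haA : Filter.Tendsto (fun n : ℕ => (a n) ^ (-(1 : ℝ) / 2) / (A * (n : ℝ) ^ aexp))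
      Filter.atTop (nhds 1))
    (hbB : Filter.Tendsto (fun n : ℕ => b n / (B * (n : ℝ) ^ bexp)) Filter.atTop (nhds 1))
    (hlink : 2 * aexp + 1 = 2 * bexp * (ν + 1))
    (hMHeven : ∀ K : Set ℂ, IsCompact K →
      TendstoUniformlyOn
        (fun (n : ℕ) (z : ℂ) =>
          (((-1 : ℝ) ^ n * (a n) ^ ((1 : ℝ) / 2) : ℝ) : ℂ) *
            Polynomial.aeval (z / (b n : ℂ)) (p (2 * n)))
        (fun z => phi ν z) Filter.atTop K)
    (hMHodd : ∀ K : Set ℂ, IsCompact K →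
      TendstoUniformlyOn
        (fun (n : ℕ) (z : ℂ) =>
          (((-1 : ℝ) ^ n * (a n) ^ ((1 : ℝ) / 2) : ℝ) : ℂ) *
            Polynomial.aeval (z / (b n : ℂ)) (p (2 * n + 1)))
        (fun z => z * phi (ν + 1) z) Filter.atTop K)
    (hgammaEven : Filter.Tendsto
      (fun n : ℕ => (p (2 * n)).leadingCoeff / (p (2 * n + 1)).leadingCoeff * (b n / n))
      Filter.atTop (nhds (1 / (2 * bexp))))
    (hgammaOdd : Filter.Tendsto
      (fun n : ℕ => (p (2 * n + 1)).leadingCoeff / (p (2 * n + 2)).leadingCoeff * (b n / n))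
      Filter.atTop (nhds (1 / (2 * bexp)))) :
    ∀ j : ℕ, ∀ K : Set ℂ, IsCompact K →
      (TendstoUniformlyOn
        (fun (n : ℕ) (z : ℂ) =>
          (((-1 : ℝ) ^ n * ((a n) ^ ((1 : ℝ) / 2) / (b n) ^ j) : ℝ) : ℂ) *
            Polynomial.aeval (z / (b n : ℂ)) (P j (2 * n)))
        (fun z => phi (ν + j) z) Filter.atTop K) ∧
      (TendstoUniformlyOn
        (fun (n : ℕ) (z : ℂ) =>
          (((-1 : ℝ) ^ n * ((a n) ^ ((1 : ℝ) / 2) / (b n) ^ j) : ℝ) : ℂ) *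
            Polynomial.aeval (z / (b n : ℂ)) (P j (2 * n + 1)))
        (fun z => z * phi (ν + j + 1) z) Filter.atTop K) := by
  have hL : ∀ (j : ℕ) (r : ℝ[X]),
      (momentFunctional μ hint ∘ₗ LinearMap.mulLeft ℝ (X ^ (2 * j))) (r.comp (-X)) =
        (momentFunctional μ hint ∘ₗ LinearMap.mulLeft ℝ (X ^ (2 * j))) r := by
    intro j r
    have := momentFunctional_comp_neg hint hsym (X ^ (2 * j) * r)
    rw [mul_comp, X_pow_comp, (even_two_mul j).neg_pow] at this
    exact this
  have hLL : ∀ (j : ℕ) (r : ℝ[X]),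
      (momentFunctional μ hint ∘ₗ LinearMap.mulLeft ℝ (X ^ (2 * (j + 1)))) r =
        (momentFunctional μ hint ∘ₗ LinearMap.mulLeft ℝ (X ^ (2 * j))) (X ^ 2 * r) := by
    intro j r
    simp only [LinearMap.comp_apply, LinearMap.mulLeft_apply]
    rw [← mul_assoc, ← pow_add]
    rfl
  have hOPS := fun j => (hP j).isFunctionalOPS hint
  have hp' : IsOPS (muMod μ 0 (2 * 0)) p := by rwa [mul_zero, muMod_zero]
  have hP0 : P 0 = p := funext fun n => (hp'.isFunctionalOPS hint).unique (hOPS 0) n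
  set u : ℕ → ℕ → ℝ := fun j n => a n ^ (-(1 : ℝ) / 2) * b n ^ j with hu_def
  have hu : ∀ j n, 0 < u j n := fun j n =>
    mul_pos (Real.rpow_pos_of_pos (ha n) _) (pow_pos (hb n) j)
  have hu_inv : ∀ j n, a n ^ ((1 : ℝ) / 2) / b n ^ j = (u j n)⁻¹ := fun j n => by
    simp only [hu_def]
    rw [neg_div, Real.rpow_neg (ha n).le, mul_inv, inv_inv, div_eq_mul_inv]
  have hba := HasPowerAsymptotics.of_tendsto_div hbB hB
  have hua : ∀ j, HasPowerAsymptotics (u j) (aexp + j * bexp) (A * B ^ j) := fun j =>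
    (HasPowerAsymptotics.of_tendsto_div haA hA).mul (hba.pow j)
  have hMH := fun K (hK : IsCompact K) => hMHodd K hK
  simp only [← hP0, mul_phi_eq_tsum (show -1 < ν + 1 by linarith)] at hMH
  have hodd : ∀ j : ℕ, HasOddAsymptotics (u j) b bexp (ν + j + 1) (P j) := by
    intro j
    induction j with
    | zero =>
      refine ⟨?_, ?_⟩
      · rw [Nat.cast_zero, add_zero]
        refine HasScaledLimit.of_tendstoUniformlyOn
          (oddPhiCoeff_bound (by linarith)) fun K hK => ?_
        simp only [← hu_inv, pow_zero, div_one]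
        exact hMH K hK
      · rw [hP0]
        have h := ((hgammaOdd.mul (hgammaEven.comp (tendsto_add_atTop_nat 1))).mul
          HasPowerAsymptotics.tendsto_natCast_div_add_one).mul
          ((hba.tendsto_succ_div hB).inv₀ one_ne_zero)
        rw [show 1 / (2 * bexp) * (1 / (2 * bexp)) * 1 * (1 : ℝ)⁻¹ = 1 / (2 * bexp) ^ 2 by
          rw [inv_one]; ring] at h
        refine h.congr' ?_
        filter_upwards [eventually_gt_atTop 0] with n hn
        have hn' : (0 : ℝ) < n := by exact_mod_cast hn
        have h1 := (hb n).ne'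
        have h2 := (hb (n + 1)).ne'
        have h3 := (hp.2.1 (2 * n + 2)).ne'
        have h4 := (hp.2.1 (2 * n + 3)).ne'
        simp only [Function.comp, show 2 * (n + 1) = 2 * n + 2 by ring]
        push_cast
        field_simp
    | succ j ih =>
      have h := ih.succ (hL j) (hLL j) (hOPS j) (hOPS (j + 1)) (hu j) hb (hua j) (by positivity)
        hba hB hbexp (by linarith [j.cast_nonneg (α := ℝ)]) (by linear_combination hlink)
      convert! h using 1
      · funext n
        simp only [hu_def]
        ring
      · push_cast
        ring
  have heven : ∀ j : ℕ, ∀ K : Set ℂ, IsCompact K → TendstoUniformlyOn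
      (fun (n : ℕ) (z : ℂ) => (((-1 : ℝ) ^ n * (u j n)⁻¹ : ℝ) : ℂ) *
        aeval (z / (b n : ℂ)) (P j (2 * n))) (fun z => phi (ν + j) z) atTop K := by
    intro j K hK
    cases j with
    | zero =>
      simp only [← hu_inv, hP0, pow_zero, div_one, Nat.cast_zero, add_zero]
      exact hMHeven K hK
    | succ j =>
      have h := ((hodd j).limit.even_of_odd (hL j) (hLL j) (hOPS j)
        (hOPS (j + 1))).tendstoUniformlyOn hK
      simp only [← phi_eq_tsum] at h
      have hu' : u (j + 1) = fun n => u j n * b n := by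
        funext n
        simp only [hu_def]
        ring
      rw [hu', show ν + ((j + 1 : ℕ) : ℝ) = ν + j + 1 by push_cast; ring]
      exact h
  intro j K hK
  simp only [hu_inv]
  refine ⟨heven j K hK, ?_⟩
  simp only [mul_phi_eq_tsum (show -1 < ν + j + 1 by linarith [j.cast_nonneg (α := ℝ)])]
  exact (hodd j).limit.tendstoUniformlyOn hK
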